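/- There exists a finite set Σ* of TGDs such that the problem ChTrm(Σ*) — given as input a database D, decide whether chase(D,Σ*) is finite (i.e., whether Σ* ∈ CT_D) — is undecidable: no algorithm (computable function on encodings of databases) decides, for every database D, whether chase(D,Σ*) is finite. -/

import Mathlib

set_option maxHeartbeats 1000000

/-! ### Basic syntax: atoms, TGDs, terms -/

/-- An atom: a predicate name together with a list of arguments. -/
structure Atom (T : Type) where
  pred : ℕ
  args : List T
deriving DecidableEq

def Atom.map {T U : Type} (f : T → U) (a : Atom T) : Atom U :=
  ⟨a.pred, a.args.map f⟩

/-- The signature (predicate name, arity) of an atom. -/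
def Atom.sig {T : Type} (a : Atom T) : ℕ × ℕ := (a.pred, a.args.length)

def Atom.equivProd : Atom ℕ ≃ ℕ × List ℕ where
  toFun a := (a.pred, a.args)
  invFun p := ⟨p.1, p.2⟩
  left_inv a := rfl
  right_inv p := rfl

instance : Encodable (Atom ℕ) := Encodable.ofEquiv _ Atom.equivProd

/-- A tuple-generating dependency, given by its (non-empty) body and head,
whose atoms carry variables (natural numbers) as arguments. -/
structure TGD where
  body : List (Atom ℕ)
  head : List (Atom ℕ)
  body_ne : body ≠ []
  head_ne : head ≠ []

def atomVars (a : Atom ℕ) : Finset ℕ := a.args.toFinset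

def TGD.bodyVars (σ : TGD) : Finset ℕ := σ.body.foldr (fun a s => atomVars a ∪ s) ∅
def TGD.headVars (σ : TGD) : Finset ℕ := σ.head.foldr (fun a s => atomVars a ∪ s) ∅
/-- The frontier of a TGD: variables occurring both in the body and in the head. -/
def TGD.frontier (σ : TGD) : Finset ℕ := σ.bodyVars ∩ σ.headVars
/-- The existentially quantified variables: head variables not occurring in the body. -/
def TGD.exVars (σ : TGD) : Finset ℕ := σ.headVars \ σ.bodyVars

/-- Terms: constants, and labelled nulls `⊥^z_{σ,h}` determined by a TGD `σ`,
a substitution `h` (the restriction of the trigger homomorphism to the frontier)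
and a variable `z`. -/
inductive TermT : Type where
  | const : ℕ → TermT
  | null : TGD → (ℕ → TermT) → ℕ → TermT

/-- The depth of a term. -/
def TermT.depth : TermT → ℕ
  | .const _ => 0
  | .null σ h _ => 1 + σ.frontier.sup (fun x => (h x).depth)

/-- The depth of an atom: the maximal depth of its arguments. -/
def Atom.depth (a : Atom TermT) : ℕ := (a.args.map TermT.depth).foldr max 0

/-! ### The semi-oblivious chase -/

/-- Restriction of a substitution to the frontier of a TGD (with default value elsewhere). -/
def TGD.restrict (σ : TGD) (h : ℕ → TermT) : ℕ → TermT :=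
  fun x => if x ∈ σ.frontier then h x else .const 0

/-- The map `μ` sending each frontier variable `x` to `h x` and each other (existential)
variable `z` to the null `⊥^z_{σ,h|fr(σ)}`. -/
def TGD.mu (σ : TGD) (h : ℕ → TermT) : ℕ → TermT :=
  fun x => if x ∈ σ.frontier then h x else .null σ (σ.restrict h) x

/-- The result of the trigger `(σ,h)`. -/
def TGD.result (σ : TGD) (h : ℕ → TermT) : Set (Atom TermT) :=
  {a | ∃ b ∈ σ.head, a = b.map (σ.mu h)}

abbrev Database := Finset (Atom ℕ)
abbrev Instance := Set (Atom TermT)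

def dbInstance (D : Database) : Instance := (Atom.map TermT.const) '' ↑D

/-- `chase D S` (the result of any valid semi-oblivious chase derivation of `D` w.r.t. `S`),
defined as the least set of atoms containing `D` and closed under all triggers. -/
inductive InChase (D : Database) (S : Set TGD) : Atom TermT → Prop
  | db {a : Atom ℕ} : a ∈ D → InChase D S (a.map TermT.const)
  | step {σ : TGD} (hσ : σ ∈ S) (h : ℕ → TermT)
      (hb : ∀ b ∈ σ.body, InChase D S (b.map h))
      {a : Atom TermT} (ha : a ∈ σ.result h) : InChase D S a

def chase (D : Database) (S : Set TGD) : Instance := {a | InChase D S a}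

/-- The active domain of an instance: the set of terms occurring in it. -/
def adom (I : Instance) : Set TermT := {t | ∃ a ∈ I, t ∈ a.args}

/-- `Σ ∈ CT_D`: the chase of `D` w.r.t. `Σ` is finite. -/
def InCT (D : Database) (S : Set TGD) : Prop := (chase D S).Finite

open Classical in
/-- The maximal depth of a term occurring in `chase D S`, and `⊤` if the chase is infinite. -/
noncomputable def maxdepth (D : Database) (S : Set TGD) : ℕ∞ :=
  if (chase D S).Finite then ⨆ t ∈ adom (chase D S), (TermT.depth t : ℕ∞) else ⊤

/-! ### Schema, arity, classes of TGDs -/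

def TGD.atomsList (σ : TGD) : List (Atom ℕ) := σ.body ++ σ.head

/-- The schema of a set of TGDs: the (predicate name, arity) pairs occurring in it. -/
def sch (S : Set TGD) : Set (ℕ × ℕ) := {p | ∃ σ ∈ S, ∃ a ∈ σ.atomsList, a.sig = p}

/-- The maximal arity of a predicate of the schema. -/
noncomputable def arity (S : Set TGD) : ℕ := sSup ((fun p => p.2) '' sch S)

/-- The set of atoms occurring in the TGDs of `S`. -/
def atomsOf (S : Set TGD) : Set (Atom ℕ) := {a | ∃ σ ∈ S, a ∈ σ.atomsList}

/-- `‖Σ‖ = |atoms(Σ)| · |sch(Σ)| · ar(Σ)`. -/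
noncomputable def tgdNorm (S : Set TGD) : ℕ := (atomsOf S).ncard * (sch S).ncard * arity S

/-- A TGD is guarded if some body atom contains all body variables. -/
def TGD.Guarded (σ : TGD) : Prop := ∃ a ∈ σ.body, σ.bodyVars ⊆ atomVars a

/-- A TGD is linear if its body consists of a single atom. -/
def TGD.Linear (σ : TGD) : Prop := ∃ a, σ.body = [a]

/-- A TGD is simple linear if its body is a single atom without repeated variables. -/
def TGD.SimpleLinear (σ : TGD) : Prop := ∃ a, σ.body = [a] ∧ a.args.Nodup

/-- The guard of a TGD: the leftmost body atom containing all body variables. -/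
def TGD.guard (σ : TGD) : Atom ℕ :=
  (σ.body.find? (fun a => decide (σ.bodyVars ⊆ atomVars a))).getD ⟨0, []⟩

/-! ### Chase derivations and the guarded chase forest -/

def IsTrigger (S : Set TGD) (σ : TGD) (h : ℕ → TermT) (I : Instance) : Prop :=
  σ ∈ S ∧ ∀ b ∈ σ.body, b.map h ∈ I

def IsActive (S : Set TGD) (σ : TGD) (h : ℕ → TermT) (I : Instance) : Prop :=
  IsTrigger S σ h I ∧ ¬ σ.result h ⊆ I

/-- A chase derivation of `D` w.r.t. `S`: at each step either an active trigger is applied,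
or no active trigger exists and the instance stays put (the derivation has terminated). -/
structure ChaseDerivation (D : Database) (S : Set TGD) where
  inst : ℕ → Instance
  trig : ℕ → Option (TGD × (ℕ → TermT))
  init : inst 0 = dbInstance D
  step_some : ∀ i σ h, trig i = some (σ, h) →
    IsActive S σ h (inst i) ∧ inst (i + 1) = inst i ∪ σ.result h
  step_none : ∀ i, trig i = none →
    (∀ σ h, ¬ IsActive S σ h (inst i)) ∧ inst (i + 1) = inst i

/-- The derivation is finite: it eventually reaches an instance with no active trigger. -/
def ChaseDerivation.IsFiniteDer {D : Database} {S : Set TGD} (δ : ChaseDerivation D S) : Prop :=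
  ∃ i, δ.trig i = none

/-- Fairness: every active trigger eventually becomes non-active. -/
def ChaseDerivation.Fair {D : Database} {S : Set TGD} (δ : ChaseDerivation D S) : Prop :=
  ∀ i σ h, IsActive S σ h (δ.inst i) → ∃ j, i < j ∧ ¬ IsActive S σ h (δ.inst j)

def ChaseDerivation.Valid {D : Database} {S : Set TGD} (δ : ChaseDerivation D S) : Prop :=
  δ.IsFiniteDer ∨ δ.Fair

/-- The edge relation of the guarded chase forest of a derivation. -/
def gedge {D : Database} {S : Set TGD} (δ : ChaseDerivation D S) (α β : Atom TermT) : Prop :=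
  ∃ i σ h, δ.trig i = some (σ, h) ∧ α = (TGD.guard σ).map h ∧
    β ∈ δ.inst (i + 1) \ δ.inst i

/-- The tree of the guarded chase forest rooted at the database atom `α`. -/
def gtree {D : Database} {S : Set TGD} (δ : ChaseDerivation D S) (α : Atom ℕ) : Set (Atom TermT) :=
  {β | Relation.ReflTransGen (gedge δ) (α.map TermT.const) β}

/-- The atoms of depth `i` in the tree rooted at `α`. -/
def gtreeLevel {D : Database} {S : Set TGD} (δ : ChaseDerivation D S) (α : Atom ℕ) (i : ℕ) :
    Set (Atom TermT) :=
  {β ∈ gtree δ α | Atom.depth β = i}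

/-! ### Dependency graph, reachability and non-uniform weak-acyclicity -/

/-- A position `(R, i)` of a schema: a (predicate name, arity) pair and an argument index. -/
abbrev Pos := (ℕ × ℕ) × ℕ

def occursAt {T : Type} (x : T) (a : Atom T) (p : Pos) : Prop :=
  p.1 = a.sig ∧ a.args[p.2]? = some x

/-- Normal edges of the dependency graph. -/
def NormalEdge (S : Set TGD) (p q : Pos) : Prop :=
  ∃ σ ∈ S, ∃ x ∈ σ.frontier, (∃ a ∈ σ.body, occursAt x a p) ∧ (∃ b ∈ σ.head, occursAt x b q)

/-- Special edges of the dependency graph. -/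
def SpecialEdge (S : Set TGD) (p q : Pos) : Prop :=
  ∃ σ ∈ S, ∃ x ∈ σ.frontier, (∃ a ∈ σ.body, occursAt x a p) ∧
    (∃ z ∈ σ.exVars, ∃ b ∈ σ.head, occursAt z b q)

def predEdge (S : Set TGD) (R P : ℕ × ℕ) : Prop :=
  ∃ σ ∈ S, (∃ a ∈ σ.body, a.sig = R) ∧ (∃ b ∈ σ.head, b.sig = P)

/-- `R ⤳_Σ P`: predicate reachability. -/
def Reach (S : Set TGD) : (ℕ × ℕ) → (ℕ × ℕ) → Prop := Relation.ReflTransGen (predEdge S)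

/-- `Σ` is `D`-weakly-acyclic: no `D`-supported cycle of the dependency graph
contains a special edge. -/
def DWeaklyAcyclic (D : Database) (S : Set TGD) : Prop :=
  ¬ ∃ (n : ℕ) (c : ℕ → Pos) (sp : ℕ → Bool),
      c (n + 1) = c 0 ∧
      (∀ i ≤ n, if sp i then SpecialEdge S (c i) (c (i + 1))
                else NormalEdge S (c i) (c (i + 1))) ∧
      (∃ i ≤ n, sp i = true) ∧
      (∃ i ≤ n, ∃ a ∈ D, Reach S a.sig (c i).1)

noncomputable def dSL (S : Set TGD) : ℕ := (sch S).ncard * arity S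
noncomputable def fSL (S : Set TGD) : ℕ := (dSL S + 1) * tgdNorm S ^ (2 * arity S * (dSL S + 1))
noncomputable def dL (S : Set TGD) : ℕ := (sch S).ncard * arity S ^ (arity S + 1)
noncomputable def fL (S : Set TGD) : ℕ := (dL S + 1) * tgdNorm S ^ (2 * arity S * (dL S + 1))
noncomputable def dG (S : Set TGD) : ℕ :=
  (sch S).ncard * arity S ^ (2 * arity S + 1) * 2 ^ ((sch S).ncard * arity S ^ arity S)
noncomputable def fG (S : Set TGD) : ℕ := (dG S + 1) * tgdNorm S ^ (2 * arity S * (dG S + 1))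

/-! ### Simplification -/

open Classical in
/-- `unique(t̄)`: keep only the first occurrence of each term. -/
noncomputable def uniqueList {α : Type} : List α → List α
  | [] => []
  | a :: l => a :: uniqueList (l.filter fun b => decide (b ≠ a))
termination_by l => l.length
decreasing_by
  simp only [List.length_cons, List.length_unattach]
  exact Nat.lt_succ_of_le ((List.length_filter_le _ _).trans_eq List.length_attach)

open Classical in
/-- `id(t̄)`: for each component, the position of `unique(t̄)` at which it appears. -/
noncomputable def idTuple {α : Type} (l : List α) : List ℕ :=
  l.map (fun t => (uniqueList l).idxOf t)

/-- The simplification of an atom `R(t̄)`: the atom `R_{id(t̄)}(unique(t̄))`, where the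
fresh predicate name `R_{id(t̄)}` is obtained by pairing `R` with an encoding of `id(t̄)`. -/
noncomputable def simpleAtom {α : Type} (a : Atom α) : Atom α :=
  ⟨Nat.pair a.pred (Encodable.encode (idTuple a.args)), uniqueList a.args⟩

/-- `simple(D)`. -/
noncomputable def simpleDB (D : Database) : Database := D.image simpleAtom

/-- A specialization of the tuple of variables `xs`:
`f x₁ = x₁`, `f xᵢ ∈ {f x₁, …, f xᵢ₋₁, xᵢ}`, and `f` is the identity off `xs`. -/
def IsSpecialization (xs : List ℕ) (f : ℕ → ℕ) : Prop :=
  (∀ v, v ∉ xs → f v = v) ∧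
  ∀ i : Fin xs.length, f (xs.get i) ∈ ((xs.take i).map f) ++ [xs.get i]

/-- The body atom of a (linear) TGD. -/
def TGD.bodyAtom (σ : TGD) : Atom ℕ := σ.body.head σ.body_ne

/-- The simplification of a linear TGD induced by a specialization `f`. -/
noncomputable def TGD.simplify (σ : TGD) (f : ℕ → ℕ) : TGD where
  body := [simpleAtom (σ.bodyAtom.map f)]
  head := σ.head.map (fun b => simpleAtom (b.map f))
  body_ne := by simp
  head_ne := by
    intro hcon
    exact σ.head_ne (List.map_eq_nil_iff.mp hcon)

/-- `simple(Σ)`: all simplifications of TGDs of `Σ` induced by some specialization. -/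
def simpleTGDs (S : Set TGD) : Set TGD :=
  {τ | ∃ σ ∈ S, ∃ f : ℕ → ℕ, IsSpecialization σ.bodyAtom.args f ∧ τ = σ.simplify f}

/-- Equivalence of terms up to simplification: the map
`g = {f x ↦ h x : x ∈ fr(σ)}` is a well-defined function on `fr(σ_f)` (witnessed by the
section `sec` of `f`), and `g y ≡_sim h' y` for every `y ∈ fr(σ_f)`. -/
inductive EqSim : TermT → TermT → Prop
  | const (c : ℕ) : EqSim (.const c) (.const c)
  | null (σ : TGD) (f : ℕ → ℕ) (sec : ℕ → ℕ) (h h' : ℕ → TermT) (z : ℕ)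
      (hf : IsSpecialization σ.bodyAtom.args f)
      (hfun : ∀ x ∈ σ.frontier, ∀ y ∈ σ.frontier, f x = f y → h x = h y)
      (hdom : ∀ x ∈ σ.frontier, f x ∈ (σ.simplify f).frontier)
      (hsec : ∀ y ∈ (σ.simplify f).frontier, sec y ∈ σ.frontier ∧ f (sec y) = y)
      (hrec : ∀ y ∈ (σ.simplify f).frontier, EqSim (h (sec y)) (h' y)) :
      EqSim (.null σ h z) (.null (σ.simplify f) h' z)

/-- `t̄ ≃ ū`: same length and the same equalities among components. -/
def tupleEquiv {A B : Type} (t : List A) (u : List B) : Prop :=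
  t.length = u.length ∧ ∀ i j, i < t.length → j < t.length → (t[i]? = t[j]? ↔ u[i]? = u[j]?)

/-- Equivalence of atoms up to simplification. -/
noncomputable def AtomEqSim (α β : Atom TermT) : Prop :=
  β.pred = Nat.pair α.pred (Encodable.encode (idTuple α.args)) ∧
  tupleEquiv (uniqueList α.args) β.args ∧
  List.Forall₂ EqSim (uniqueList α.args) β.args

/-! ### Linearization -/

/-- The symbolic representation of a type: a canonical guard atom over positive integers
together with a finite set of further atoms over its terms. -/
abbrev SigmaType := Atom ℕ × Finset (Atom ℕ)

/-- A canonical tuple of positive integers: `t₁ = 1` and `tᵢ ≤ max(t₁,…,tᵢ₋₁) + 1`. -/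
def IsCanonicalTuple (l : List ℕ) : Prop :=
  ∀ (i : ℕ) (h : i < l.length), 1 ≤ l[i] ∧ l[i] ≤ ((l.take i).foldr max 0) + 1

def atomsOfType (τ : SigmaType) : Finset (Atom ℕ) := insert τ.1 τ.2

def IsSigmaType (S : Set TGD) (τ : SigmaType) : Prop :=
  IsCanonicalTuple τ.1.args ∧ τ.1.sig ∈ sch S ∧
  (∀ b ∈ τ.2, b.sig ∈ sch S ∧ ∀ t ∈ b.args, t ∈ τ.1.args) ∧ τ.1 ∉ τ.2

open Classical in
noncomputable def setToFinset {α : Type} (s : Set α) : Finset α :=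
  if h : s.Finite then h.toFinset else ∅

open Classical in
/-- Canonical renaming: the `i`-th distinct value of `base` (by first occurrence)
is sent to the integer `i` (1-based). -/
noncomputable def canonInt {α : Type} (base : List α) (c : α) : ℕ :=
  (uniqueList base).idxOf c + 1

/-- The type (over the constants of `a`) of the database atom `a` w.r.t. `D` and `S`. -/
def typeOfDBAtom (D : Database) (S : Set TGD) (a : Atom ℕ) : Set (Atom ℕ) :=
  {b | (b.map TermT.const) ∈ chase D S ∧ ∀ c ∈ b.args, c ∈ a.args}

/-- The linearization of a database atom: `[τ](t̄)` where `τ` encodes the atom and its type. -/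
noncomputable def linAtom (D : Database) (S : Set TGD) (a : Atom ℕ) : Atom ℕ :=
  let ρ : ℕ → ℕ := canonInt a.args
  let g : Atom ℕ := a.map ρ
  let τ : SigmaType := (g, (setToFinset ((Atom.map ρ) '' typeOfDBAtom D S a)).erase g)
  ⟨Encodable.encode τ, a.args⟩

/-- `lin(D)`. -/
noncomputable def linDB (D : Database) (S : Set TGD) : Database := D.image (linAtom D S)

/-- `complete(I,Σ)`: the atoms of the chase of `I` whose terms all belong to `adom(I)`. -/
def completeDB (I : Database) (S : Set TGD) : Set (Atom ℕ) :=
  {a | (a.map TermT.const) ∈ chase I S ∧ ∀ c ∈ a.args, ∃ b ∈ I, c ∈ b.args}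

/-- The index (1-based) of an existential variable of a TGD. -/
noncomputable def TGD.exIndex (σ : TGD) (v : ℕ) : ℕ := (σ.exVars.sort (· ≤ ·)).idxOf v + 1

/-- The function `f` of the linearization: frontier variables are mapped by `h`, the `i`-th
existential variable to `ar(Σ) + i`. -/
noncomputable def headMap (S : Set TGD) (σ : TGD) (h : ℕ → ℕ) : ℕ → ℕ :=
  fun v => if v ∈ σ.frontier then h v else arity S + σ.exIndex v

/-- The Σ-type associated with the head atom `b` of `σ` in the linearization step. -/
noncomputable def headTypeOf (S : Set TGD) (σ : TGD) (τ : SigmaType) (h : ℕ → ℕ)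
    (b : Atom ℕ) : SigmaType :=
  let f := headMap S σ h
  let αi : Atom ℕ := b.map f
  let I : Database := (σ.head.map (Atom.map f)).toFinset ∪ atomsOfType τ
  let Ti : Set (Atom ℕ) := {β | β ∈ completeDB I S ∧ ∀ t ∈ β.args, t ∈ αi.args} \ {αi}
  let ρ : ℕ → ℕ := canonInt αi.args
  (αi.map ρ, setToFinset ((Atom.map ρ) '' Ti))

/-- The linearization of the guarded TGD `σ` induced by the Σ-type `τ` and the
homomorphism `h` from `body(σ)` to `atoms(τ)` mapping the guard to `guard(τ)`. -/
noncomputable def linTGD (S : Set TGD) (σ : TGD) (τ : SigmaType) (h : ℕ → ℕ) : TGD where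
  body := [⟨Encodable.encode τ, σ.guard.args⟩]
  head := σ.head.map (fun b => ⟨Encodable.encode (headTypeOf S σ τ h b), b.args⟩)
  body_ne := by simp
  head_ne := by
    intro hcon
    exact σ.head_ne (List.map_eq_nil_iff.mp hcon)

def IsTypeHom (S : Set TGD) (σ : TGD) (τ : SigmaType) (h : ℕ → ℕ) : Prop :=
  (∀ b ∈ σ.body, b.map h ∈ atomsOfType τ) ∧ σ.guard.map h = τ.1

/-- `lin(Σ)`. -/
def linTGDs (S : Set TGD) : Set TGD :=
  {ρ | ∃ σ ∈ S, ∃ τ : SigmaType, IsSigmaType S τ ∧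
    ∃ h : ℕ → ℕ, IsTypeHom S σ τ h ∧ ρ = linTGD S σ τ h}

/-- Equivalence of terms up to linearization. -/
inductive EqLin (S : Set TGD) : TermT → TermT → Prop
  | const (c : ℕ) : EqLin S (.const c) (.const c)
  | null (σ : TGD) (τ : SigmaType) (g : ℕ → ℕ) (h h' : ℕ → TermT) (z : ℕ)
      (hτ : IsSigmaType S τ) (hg : IsTypeHom S σ τ g)
      (hfr : ∀ y ∈ (linTGD S σ τ g).frontier, EqLin S (h y) (h' y)) :
      EqLin S (.null σ h z) (.null (linTGD S σ τ g) h' z)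

/-- The type of an atom of the chase: all chase atoms whose terms occur in it. -/
def typeOf (D : Database) (S : Set TGD) (α : Atom TermT) : Set (Atom TermT) :=
  {β ∈ chase D S | ∀ t ∈ β.args, t ∈ α.args}

/-- Equivalence of atoms up to linearization. -/
def AtomEqLin (D : Database) (S : Set TGD) (α β : Atom TermT) : Prop :=
  ∃ τ : SigmaType, β.pred = Encodable.encode τ ∧ IsSigmaType S τ ∧
    (∃ μ : TermT → ℕ,
      Set.BijOn μ (adom (typeOf D S α)) {k | ∃ a ∈ atomsOfType τ, k ∈ a.args} ∧
      (Atom.map μ) '' typeOf D S α = ↑(atomsOfType τ) ∧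
      α.map μ = τ.1) ∧
    tupleEquiv α.args β.args ∧ List.Forall₂ (EqLin S) α.args β.args

noncomputable def gsimpleDB (D : Database) (S : Set TGD) : Database := simpleDB (linDB D S)
def gsimpleTGDs (S : Set TGD) : Set TGD := simpleTGDs (linTGDs S)


namespace ChaseUndec

open Encodable

/-! ### General facts on the chase -/

theorem mem_foldr_vars (l : List (Atom ℕ)) (x : ℕ) :
    x ∈ l.foldr (fun a s => atomVars a ∪ s) ∅ ↔ ∃ a ∈ l, x ∈ a.args := by
  induction l with
  | nil => simp
  | cons a l ih =>
    rw [List.foldr_cons, Finset.mem_union, ih]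
    simp [atomVars]

theorem mem_bodyVars (σ : TGD) (x : ℕ) : x ∈ σ.bodyVars ↔ ∃ a ∈ σ.body, x ∈ a.args :=
  mem_foldr_vars _ _

theorem mem_headVars (σ : TGD) (x : ℕ) : x ∈ σ.headVars ↔ ∃ a ∈ σ.head, x ∈ a.args :=
  mem_foldr_vars _ _

theorem mem_frontier (σ : TGD) (x : ℕ) :
    x ∈ σ.frontier ↔ x ∈ σ.bodyVars ∧ x ∈ σ.headVars := by
  simp [TGD.frontier]

/-- Terms generated up to level `n`. -/
def TS (S : Set TGD) (C : Set TermT) : ℕ → Set TermT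
  | 0 => C
  | n + 1 => TS S C n ∪ {t | ∃ σ ∈ S, ∃ z ∈ σ.headVars, ∃ h : ℕ → TermT,
      (∀ x ∈ σ.frontier, h x ∈ TS S C n) ∧ t = .null σ (σ.restrict h) z}

theorem TS_mono (S : Set TGD) (C : Set TermT) {m n : ℕ} (h : m ≤ n) : TS S C m ⊆ TS S C n := by
  induction h with
  | refl => exact subset_rfl
  | step _ ih => exact ih.trans Set.subset_union_left

open Classical in
theorem TS_finite {S : Set TGD} (hS : S.Finite) {C : Set TermT} (hC : C.Finite) (n : ℕ) :
    (TS S C n).Finite := by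
  induction n with
  | zero => exact hC
  | succ n ih =>
    refine ih.union ?_
    have key : (⋃ σ ∈ S, ⋃ z ∈ (σ.headVars : Set ℕ),
        Set.range (fun k : (↥σ.frontier → ↥(TS S C n)) =>
          TermT.null σ (fun x => if hx : x ∈ σ.frontier then (k ⟨x, hx⟩).1 else .const 0) z)).Finite := by
      refine hS.biUnion fun σ _ => ?_
      refine (Finset.finite_toSet _).biUnion fun z _ => ?_
      have := ih.to_subtype
      exact Set.finite_range _
    refine key.subset ?_
    rintro t ⟨σ, hσ, z, hz, h, hh, rfl⟩
    simp only [Set.mem_iUnion]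
    refine ⟨σ, hσ, z, hz, fun x => ⟨h x.1, hh x.1 x.2⟩, ?_⟩
    simp only [TermT.null.injEq, true_and, and_true]
    funext x
    by_cases hx : x ∈ σ.frontier <;> simp [TGD.restrict, hx]

theorem lists_finite {α : Type} {s : Set α} (hs : s.Finite) (n : ℕ) :
    {l : List α | l.length = n ∧ ∀ x ∈ l, x ∈ s}.Finite := by
  induction n with
  | zero =>
    refine (Set.finite_singleton []).subset ?_
    rintro l ⟨h, _⟩
    simpa using h
  | succ n ih =>
    refine (Set.Finite.image2 List.cons hs ih).subset ?_
    rintro l ⟨h, h2⟩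
    cases l with
    | nil => simp at h
    | cons a l => exact ⟨a, h2 a (by simp), l, ⟨by simpa using h, fun x hx => h2 x (by simp [hx])⟩, rfl⟩

section Fin
variable {X : Type} (M : ℕ → List X → Prop) (rk : X → ℕ)

def Good (σ : TGD) (g : ℕ → X) : Prop :=
  (∀ b ∈ σ.head, M b.pred (b.args.map g)) ∧
  ∀ z ∈ σ.headVars, z ∉ σ.bodyVars → ∃ m, rk (g z) = m + 1 ∧ ∀ x ∈ σ.frontier, rk (g x) ≤ m

open Classical in
noncomputable def wit (σ : TGD) (g : ℕ → X) : ℕ → X :=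
  if h : ∃ g', (∀ x ∈ σ.frontier, g' x = g x) ∧ Good M rk σ g' then h.choose else g

theorem wit_spec (σ : TGD) (g : ℕ → X)
    (h : ∃ g', (∀ x ∈ σ.frontier, g' x = g x) ∧ Good M rk σ g') :
    (∀ x ∈ σ.frontier, wit M rk σ g x = g x) ∧ Good M rk σ (wit M rk σ g) := by
  unfold wit
  rw [dif_pos h]
  exact h.choose_spec

noncomputable def tval (c : ℕ → X) : TermT → X
  | .const n => c n
  | .null σ h z => wit M rk σ (fun x => tval c (h x)) z

theorem chase_finite {S : Set TGD} (hS : S.Finite) (D : Database) (c : ℕ → X) (B : ℕ)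
    (hD : ∀ a ∈ D, M a.pred (a.args.map c))
    (hM : ∀ σ ∈ S, ∀ g : ℕ → X, (∀ b ∈ σ.body, M b.pred (b.args.map g)) →
      ∃ g', (∀ x ∈ σ.frontier, g' x = g x) ∧ Good M rk σ g')
    (hB : ∀ p l, M p l → ∀ x ∈ l, rk x ≤ B) : (chase D S).Finite := by
  set v := tval M rk c with hv
  set C : Set TermT := ⋃ a ∈ (D : Set (Atom ℕ)), {t | t ∈ a.args.map TermT.const} with hC
  have hCf : C.Finite := (Finset.finite_toSet D).biUnion fun a _ => List.finite_toSet _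
  have main : ∀ a, InChase D S a → M a.pred (a.args.map v) ∧
      (∀ t ∈ a.args, t ∈ TS S C (rk (v t))) ∧
      ((∃ b ∈ D, a = b.map TermT.const) ∨ ∃ σ ∈ S, ∃ b ∈ σ.head, a.pred = b.pred ∧
        a.args.length = b.args.length) := by
    intro a ha
    induction ha with
    | @db a ha =>
      refine ⟨?_, ?_, Or.inl ⟨a, ha, rfl⟩⟩
      · have := hD a ha
        simp only [Atom.map, List.map_map]
        exact this
      · intro t ht
        apply TS_mono S C (Nat.zero_le _)
        simp only [TS, hC, Set.mem_iUnion]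
        exact ⟨a, ha, ht⟩
    | @step σ hσ h hb a ha ih =>
      obtain ⟨b, hbm, rfl⟩ := ha
      have h1 := hM σ hσ (fun x => v (h x)) (fun b hb => by
        have := (ih b hb).1
        simpa [Atom.map, Function.comp_def] using this)
      have hw : wit M rk σ (fun x => v (σ.restrict h x)) = wit M rk σ (fun x => v (σ.restrict h x)) := rfl
      have h2 : ∃ g', (∀ x ∈ σ.frontier, g' x = v (σ.restrict h x)) ∧ Good M rk σ g' := by
        obtain ⟨g', hg, hg'⟩ := h1
        exact ⟨g', fun x hx => by rw [hg x hx]; simp [TGD.restrict, hx], hg'⟩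
      obtain ⟨w1, w2, w3⟩ := wit_spec M rk σ _ h2
      set w := wit M rk σ (fun x => v (σ.restrict h x)) with hwdef
      have hmu : ∀ x, v (σ.mu h x) = w x := by
        intro x
        unfold TGD.mu
        split_ifs with hx
        · rw [w1 x hx]; simp [TGD.restrict, hx]
        · rfl
      have hfr : ∀ x ∈ σ.bodyVars, h x ∈ TS S C (rk (v (h x))) := by
        intro x hx
        obtain ⟨b, hb1, hb2⟩ := (mem_bodyVars σ x).1 hx
        exact (ih b hb1).2.1 _ (by simp only [Atom.map, List.mem_map]; exact ⟨x, hb2, rfl⟩)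
      refine ⟨?_, ?_, Or.inr ⟨σ, hσ, b, hbm, rfl, by simp [Atom.map]⟩⟩
      · have := w2 b hbm
        simp only [Atom.map, List.map_map]
        have e : v ∘ σ.mu h = w := funext hmu
        rw [e]; exact this
      · intro t ht
        simp only [Atom.map, List.mem_map] at ht
        obtain ⟨x, hx, rfl⟩ := ht
        have hxh : x ∈ σ.headVars := (mem_headVars σ x).2 ⟨b, hbm, hx⟩
        by_cases hxb : x ∈ σ.bodyVars
        · have : σ.mu h x = h x := by simp [TGD.mu, mem_frontier, hxb, hxh]
          rw [this]; exact hfr x hxb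
        · obtain ⟨m, hm, hm2⟩ := w3 x hxh hxb
          rw [hmu, hm]
          right
          refine ⟨σ, hσ, x, hxh, h, fun y hy => ?_, by simp [TGD.mu, mem_frontier, hxb]⟩
          refine TS_mono S C ?_ (hfr y ((mem_frontier σ y).1 hy).1)
          have := hm2 y hy
          rw [w1 y hy] at this
          simpa [TGD.restrict, hy] using this
  have hT : (TS S C B).Finite := TS_finite hS hCf B
  have hfin : (((Atom.map TermT.const) '' (D : Set (Atom ℕ))) ∪ ⋃ σ ∈ S, ⋃ b ∈ {b | b ∈ σ.head},
      (fun l => (⟨b.pred, l⟩ : Atom TermT)) ''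
        {l : List TermT | l.length = b.args.length ∧ ∀ x ∈ l, x ∈ TS S C B}).Finite := by
    refine Set.Finite.union ((Finset.finite_toSet D).image _) ?_
    refine hS.biUnion fun σ _ => ?_
    refine (List.finite_toSet _).biUnion fun b _ => ?_
    exact (lists_finite hT _).image _
  refine hfin.subset ?_
  intro a ha
  obtain ⟨m1, m2, m3⟩ := main a ha
  rcases m3 with ⟨b, hb, rfl⟩ | ⟨σ, hσ, b, hb, e1, e2⟩
  · left; exact ⟨b, hb, rfl⟩
  · right
    simp only [Set.mem_iUnion]
    refine ⟨σ, hσ, b, hb, a.args, ⟨e2, fun x hx => ?_⟩, ?_⟩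
    · exact TS_mono S C (hB _ _ m1 _ (List.mem_map_of_mem hx)) (m2 x hx)
    · rw [← e1]
end Fin

end ChaseUndec

namespace ChaseUndec

open Encodable

/-! ### Tree rewriting systems and their compilation into TGDs -/

inductive Tr : Type
  | leaf (i : ℕ) : Tr
  | pair (a b : Tr) : Tr

inductive LP : Type
  | any : LP
  | leaf (i : ℕ) : LP
  | pair (a b : LP) : LP

inductive RP : Type
  | pos (p : List Bool) : RP
  | leaf (i : ℕ) : RP
  | pair (a b : RP) : RP
deriving Encodable

def LP.Matches (θ : List Bool → Tr) : LP → List Bool → Prop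
  | .any, _ => True
  | .leaf i, p => θ p = .leaf i
  | .pair a b, p => θ p = .pair (θ (false :: p)) (θ (true :: p)) ∧
      a.Matches θ (false :: p) ∧ b.Matches θ (true :: p)

def LP.poss : LP → List Bool → List (List Bool)
  | .any, p => [p]
  | .leaf _, p => [p]
  | .pair a b, p => p :: (a.poss (false :: p) ++ b.poss (true :: p))

def RP.eval (θ : List Bool → Tr) : RP → Tr
  | .pos p => θ p
  | .leaf i => .leaf i
  | .pair a b => .pair (a.eval θ) (b.eval θ)

def RP.uses : RP → List (List Bool)
  | .pos p => [p]
  | .leaf _ => []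
  | .pair a b => a.uses ++ b.uses

abbrev Rule := LP × RP

def Rule.WF (ρ : Rule) : Prop := ∀ p ∈ ρ.2.uses, p ∈ ρ.1.poss []

def Step (R : List Rule) (s s' : Tr) : Prop :=
  ∃ ρ ∈ R, ∃ θ : List Bool → Tr, s = θ [] ∧ ρ.1.Matches θ [] ∧ s' = ρ.2.eval θ

inductive Reach (R : List Rule) (s0 : Tr) : ℕ → Tr → Prop
  | zero : Reach R s0 0 s0
  | succ {n s s'} : Reach R s0 n s → Step R s s' → Reach R s0 (n + 1) s'

/-- Variables of the TGDs: positions of the left pattern, subpatterns of the right pattern,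
and two time variables. -/
abbrev Vr := List Bool ⊕ RP ⊕ Bool

abbrev told : Vr := .inr (.inr false)
abbrev tnew : Vr := .inr (.inr true)

def LP.flat : LP → List Bool → List (ℕ × List Vr)
  | .any, _ => []
  | .leaf i, p => [(i, [.inl p])]
  | .pair a b, p => (0, [.inl p, .inl (false :: p), .inl (true :: p)]) ::
      (a.flat (false :: p) ++ b.flat (true :: p))

def RP.nm : RP → Vr
  | .pos p => .inl p
  | .leaf i => .inr (.inl (.leaf i))
  | .pair a b => .inr (.inl (.pair a b))

def RP.flat : RP → List (ℕ × List Vr)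
  | .pos _ => []
  | .leaf i => [(i, [(RP.leaf i).nm])]
  | .pair a b => (0, [(RP.pair a b).nm, a.nm, b.nm]) :: (a.flat ++ b.flat)

def mkAtom (x : ℕ × List Vr) : Atom ℕ := ⟨x.1, x.2.map encode⟩

def bodyL (ρ : Rule) : List (ℕ × List Vr) := (0, [.inl [], told]) :: ρ.1.flat []
def headL (ρ : Rule) : List (ℕ × List Vr) :=
  (0, [ρ.2.nm, tnew]) :: (1, [told, tnew]) :: ρ.2.flat

def mkTGD (ρ : Rule) : TGD where
  body := (bodyL ρ).map mkAtom
  head := (headL ρ).map mkAtom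
  body_ne := by simp [bodyL]
  head_ne := by simp [headL]

theorem mem_body_iff (ρ : Rule) (x : ℕ) :
    x ∈ (mkTGD ρ).bodyVars ↔ ∃ v : Vr, x = encode v ∧ ∃ a ∈ bodyL ρ, v ∈ a.2 := by
  rw [mem_bodyVars]
  constructor
  · rintro ⟨a, ha, hx⟩
    obtain ⟨b, hb, rfl⟩ := List.mem_map.1 ha
    obtain ⟨v, hv, rfl⟩ := List.mem_map.1 hx
    exact ⟨v, rfl, b, hb, hv⟩
  · rintro ⟨v, rfl, a, ha, hv⟩
    exact ⟨mkAtom a, List.mem_map_of_mem ha, List.mem_map_of_mem hv⟩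

theorem mem_head_iff (ρ : Rule) (x : ℕ) :
    x ∈ (mkTGD ρ).headVars ↔ ∃ v : Vr, x = encode v ∧ ∃ a ∈ headL ρ, v ∈ a.2 := by
  rw [mem_headVars]
  constructor
  · rintro ⟨a, ha, hx⟩
    obtain ⟨b, hb, rfl⟩ := List.mem_map.1 ha
    obtain ⟨v, hv, rfl⟩ := List.mem_map.1 hx
    exact ⟨v, rfl, b, hb, hv⟩
  · rintro ⟨v, rfl, a, ha, hv⟩
    exact ⟨mkAtom a, List.mem_map_of_mem ha, List.mem_map_of_mem hv⟩

theorem poss_self (l : LP) (p : List Bool) : p ∈ l.poss p := by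
  cases l <;> simp [LP.poss]

theorem flat_vars (l : LP) : ∀ (p : List Bool), ∀ a ∈ l.flat p, ∀ v ∈ a.2,
    ∃ q ∈ l.poss p, v = .inl q := by
  induction l with
  | any => intro p a ha; simp [LP.flat] at ha
  | leaf i =>
    intro p a ha v hv
    simp only [LP.flat, List.mem_singleton] at ha
    subst ha
    exact ⟨p, poss_self _ _, by simpa using hv⟩
  | pair l r ihl ihr =>
    intro p a ha v hv
    simp only [LP.flat, List.mem_cons, List.mem_append] at ha
    rcases ha with rfl | ha | ha
    · simp only [List.mem_cons, List.not_mem_nil, or_false] at hv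
      rcases hv with rfl | rfl | rfl
      · exact ⟨p, poss_self _ _, rfl⟩
      · exact ⟨false :: p, by simp [LP.poss, poss_self], rfl⟩
      · exact ⟨true :: p, by simp [LP.poss, poss_self], rfl⟩
    · obtain ⟨q, hq, rfl⟩ := ihl _ a ha v hv
      exact ⟨q, by simp [LP.poss, hq], rfl⟩
    · obtain ⟨q, hq, rfl⟩ := ihr _ a ha v hv
      exact ⟨q, by simp [LP.poss, hq], rfl⟩

theorem flat_occ (l : LP) : ∀ (p : List Bool), ∀ q ∈ l.poss p, q = p ∨
    ∃ a ∈ l.flat p, (.inl q : Vr) ∈ a.2 := by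
  induction l with
  | any => intro p q hq; left; simpa [LP.poss] using hq
  | leaf i => intro p q hq; left; simpa [LP.poss] using hq
  | pair l r ihl ihr =>
    intro p q hq
    simp only [LP.poss, List.mem_cons, List.mem_append] at hq
    rcases hq with rfl | hq | hq
    · left; rfl
    · right
      rcases ihl _ q hq with rfl | ⟨a, ha, hv⟩
      · exact ⟨_, List.mem_cons_self, by simp⟩
      · exact ⟨a, by simp [LP.flat, ha], hv⟩
    · right
      rcases ihr _ q hq with rfl | ⟨a, ha, hv⟩
      · exact ⟨_, List.mem_cons_self, by simp⟩
      · exact ⟨a, by simp [LP.flat, ha], hv⟩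

theorem bodyL_vars (ρ : Rule) (v : Vr) :
    (∃ a ∈ bodyL ρ, v ∈ a.2) ↔ v = told ∨ ∃ p ∈ ρ.1.poss [], v = .inl p := by
  constructor
  · rintro ⟨a, ha, hv⟩
    simp only [bodyL, List.mem_cons] at ha
    rcases ha with rfl | ha
    · simp only [List.mem_cons, List.not_mem_nil, or_false] at hv
      rcases hv with rfl | rfl
      · right; exact ⟨[], poss_self _ _, rfl⟩
      · left; rfl
    · right; exact flat_vars _ _ a ha v hv
  · rintro (rfl | ⟨p, hp, rfl⟩)
    · exact ⟨_, List.mem_cons_self, by simp⟩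
    · rcases flat_occ _ _ p hp with rfl | ⟨a, ha, hv⟩
      · exact ⟨_, List.mem_cons_self, by simp⟩
      · exact ⟨a, by simp [bodyL, ha], hv⟩

theorem nm_cases (r : RP) : (∃ p ∈ r.uses, r.nm = .inl p) ∨ ∃ q, r.nm = .inr (.inl q) := by
  cases r <;> simp [RP.nm, RP.uses]

theorem rflat_vars (r : RP) : ∀ a ∈ r.flat, ∀ v ∈ a.2,
    (∃ p ∈ r.uses, v = .inl p) ∨ ∃ q, v = .inr (.inl q) := by
  induction r with
  | pos p => intro a ha; simp [RP.flat] at ha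
  | leaf i =>
    intro a ha v hv
    simp only [RP.flat, List.mem_singleton] at ha
    subst ha
    right; exact ⟨_, List.mem_singleton.1 hv⟩
  | pair l r ihl ihr =>
    intro a ha v hv
    simp only [RP.flat, List.mem_cons, List.mem_append] at ha
    rcases ha with rfl | ha | ha
    · simp only [List.mem_cons, List.not_mem_nil, or_false] at hv
      rcases hv with rfl | rfl | rfl
      · right; exact ⟨_, rfl⟩
      · rcases nm_cases l with ⟨p, hp, e⟩ | ⟨q, e⟩
        · left; exact ⟨p, by simp [RP.uses, hp], e⟩
        · right; exact ⟨q, e⟩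
      · rcases nm_cases r with ⟨p, hp, e⟩ | ⟨q, e⟩
        · left; exact ⟨p, by simp [RP.uses, hp], e⟩
        · right; exact ⟨q, e⟩
    · rcases ihl a ha v hv with ⟨p, hp, e⟩ | ⟨q, e⟩
      · left; exact ⟨p, by simp [RP.uses, hp], e⟩
      · right; exact ⟨q, e⟩
    · rcases ihr a ha v hv with ⟨p, hp, e⟩ | ⟨q, e⟩
      · left; exact ⟨p, by simp [RP.uses, hp], e⟩
      · right; exact ⟨q, e⟩

theorem headL_vars (ρ : Rule) (v : Vr) (h : ∃ a ∈ headL ρ, v ∈ a.2) :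
    v = told ∨ v = tnew ∨ (∃ p ∈ ρ.2.uses, v = .inl p) ∨ ∃ q, v = .inr (.inl q) := by
  obtain ⟨a, ha, hv⟩ := h
  simp only [headL, List.mem_cons] at ha
  rcases ha with rfl | rfl | ha
  · simp only [List.mem_cons, List.not_mem_nil, or_false] at hv
    rcases hv with rfl | rfl
    · right; right; exact nm_cases _
    · right; left; rfl
  · simp only [List.mem_cons, List.not_mem_nil, or_false] at hv
    rcases hv with rfl | rfl
    · left; rfl
    · right; left; rfl
  · right; right; exact rflat_vars _ a ha v hv

/-! #### The model used for termination -/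

def Mdl (R : List Rule) (s0 : Tr) (B : ℕ) : ℕ → List (Tr × ℕ) → Prop
  | i, [x] => x.1 = .leaf i ∧ x.2 ≤ B
  | 0, [s, t] => Reach R s0 t.2 s.1 ∧ s.2 ≤ t.2 ∧ t.2 ≤ B
  | 1, [s, t] => s.2 ≤ B ∧ t.2 ≤ B
  | 0, [x, a, b] => x.1 = .pair a.1 b.1 ∧ a.2 ≤ x.2 ∧ b.2 ≤ x.2 ∧ x.2 ≤ B
  | _, _ => False

theorem Mdl_bound (R : List Rule) (s0 : Tr) (B : ℕ) (p : ℕ) (l : List (Tr × ℕ))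
    (h : Mdl R s0 B p l) : ∀ x ∈ l, x.2 ≤ B := by
  unfold Mdl at h
  split at h
  · simp; exact h.2
  · simp; omega
  · simp; omega
  · simp; omega
  · exact h.elim

theorem Mdl_flat (R : List Rule) (s0 : Tr) (B : ℕ) (g : Vr → Tr × ℕ) (l : LP) :
    ∀ p : List Bool, (∀ a ∈ l.flat p, Mdl R s0 B a.1 (a.2.map g)) →
      l.Matches (fun q => (g (.inl q)).1) p ∧
      ∀ q ∈ l.poss p, (g (.inl q)).2 ≤ (g (.inl p)).2 := by
  induction l with
  | any => intro p _; simp [LP.Matches, LP.poss]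
  | leaf i =>
    intro p h
    have := h _ (List.mem_singleton.2 rfl)
    simp only [Mdl, List.map] at this
    simp [LP.Matches, LP.poss, this.1]
  | pair a b iha ihb =>
    intro p h
    have h0 := h _ List.mem_cons_self
    simp only [Mdl, List.map] at h0
    obtain ⟨a1, a2⟩ := iha (false :: p) (fun x hx => h x (by simp [LP.flat, hx]))
    obtain ⟨b1, b2⟩ := ihb (true :: p) (fun x hx => h x (by simp [LP.flat, hx]))
    refine ⟨⟨h0.1, a1, b1⟩, ?_⟩
    intro q hq
    simp only [LP.poss, List.mem_cons, List.mem_append] at hq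
    rcases hq with rfl | hq | hq
    · exact le_rfl
    · exact (a2 q hq).trans h0.2.1
    · exact (b2 q hq).trans h0.2.2.1

def newval (g : Vr → Tr × ℕ) (m : ℕ) : Vr → Tr × ℕ
  | .inl p => g (.inl p)
  | .inr (.inl q) => (q.eval (fun q => (g (.inl q)).1), m + 1)
  | .inr (.inr false) => g told
  | .inr (.inr true) => (.leaf 0, m + 1)

theorem newval_nm (g : Vr → Tr × ℕ) (m : ℕ) (r : RP) :
    (newval g m r.nm).1 = r.eval (fun q => (g (.inl q)).1) := by
  cases r <;> rfl

theorem newval_rk (g : Vr → Tr × ℕ) (m : ℕ) (r : RP) (h : ∀ p ∈ r.uses, (g (.inl p)).2 ≤ m) :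
    (newval g m r.nm).2 ≤ m + 1 := by
  cases r with
  | pos p => exact (h p (by simp [RP.uses])).trans (Nat.le_succ _)
  | leaf i => exact le_rfl
  | pair a b => exact le_rfl

theorem Mdl_rflat (R : List Rule) (s0 : Tr) (B : ℕ) (g : Vr → Tr × ℕ) (m : ℕ) (hm : m + 1 ≤ B)
    (r : RP) (h : ∀ p ∈ r.uses, (g (.inl p)).2 ≤ m) :
    ∀ a ∈ r.flat, Mdl R s0 B a.1 (a.2.map (newval g m)) := by
  induction r with
  | pos p => simp [RP.flat]
  | leaf i =>
    intro a ha
    simp only [RP.flat, List.mem_singleton] at ha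
    subst ha
    exact ⟨rfl, hm⟩
  | pair a b iha ihb =>
    have ha : ∀ p ∈ a.uses, (g (.inl p)).2 ≤ m := fun p hp => h p (by simp [RP.uses, hp])
    have hb : ∀ p ∈ b.uses, (g (.inl p)).2 ≤ m := fun p hp => h p (by simp [RP.uses, hp])
    intro x hx
    simp only [RP.flat, List.mem_cons, List.mem_append] at hx
    rcases hx with rfl | hx | hx
    · simp only [List.map, Mdl]
      refine ⟨?_, newval_rk g m a ha, newval_rk g m b hb, hm⟩
      rw [newval_nm, newval_nm, newval_nm]; rfl
    · exact iha ha x hx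
    · exact ihb hb x hx

def liftV {X : Type} (d : X) (g : Vr → X) (n : ℕ) : X :=
  match (decode n : Option Vr) with
  | some v => g v
  | none => d

@[simp] theorem liftV_encode {X : Type} (d : X) (g : Vr → X) (v : Vr) :
    liftV d g (encode v) = g v := by
  simp [liftV]

theorem mkAtom_map {X : Type} (G : ℕ → X) (a : ℕ × List Vr) :
    (mkAtom a).args.map G = a.2.map (fun v => G (encode v)) := by
  simp [mkAtom]

def tgds (R : List Rule) : Set TGD := {σ | ∃ ρ ∈ R, σ = mkTGD ρ}

theorem tgds_finite (R : List Rule) : (tgds R).Finite := by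
  refine ((List.finite_toSet R).image mkTGD).subset ?_
  rintro _ ⟨ρ, h, rfl⟩
  exact ⟨ρ, h, rfl⟩

theorem terminates (R : List Rule) (hR : ∀ ρ ∈ R, Rule.WF ρ) (s0 : Tr) (B : ℕ)
    (hB : ∀ n s, Reach R s0 n s → n ≤ B) (D : Database) (c : ℕ → Tr × ℕ)
    (hD : ∀ a ∈ D, Mdl R s0 B a.pred (a.args.map c)) : (chase D (tgds R)).Finite := by
  refine chase_finite (Mdl R s0 B) Prod.snd (tgds_finite R) D c B hD ?_ (Mdl_bound R s0 B)
  rintro _ ⟨ρ, hρ, rfl⟩ G hG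
  set g : Vr → Tr × ℕ := fun v => G (encode v) with hg
  have hb : ∀ a ∈ bodyL ρ, Mdl R s0 B a.1 (a.2.map g) := by
    intro a ha
    have := hG (mkAtom a) (List.mem_map_of_mem ha)
    rw [mkAtom_map] at this
    exact this
  have h0 := hb _ List.mem_cons_self
  simp only [List.map, Mdl] at h0
  obtain ⟨hm, hrk⟩ := Mdl_flat R s0 B g ρ.1 [] (fun a ha => hb a (by simp [bodyL, ha]))
  set m := (g told).2 with hmdef
  have hposs : ∀ p ∈ ρ.1.poss [], (g (.inl p)).2 ≤ m := fun p hp => (hrk p hp).trans h0.2.1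
  have huse : ∀ p ∈ ρ.2.uses, (g (.inl p)).2 ≤ m := fun p hp => hposs p (hR ρ hρ p hp)
  have hreach : Reach R s0 (m + 1) (ρ.2.eval fun q => (g (.inl q)).1) :=
    Reach.succ h0.1 ⟨ρ, hρ, _, rfl, hm, rfl⟩
  have hmB := hB _ _ hreach
  have agree : ∀ x ∈ (mkTGD ρ).bodyVars, liftV (.leaf 0, 0) (newval g m) x = G x ∧ (G x).2 ≤ m := by
    intro x hx
    obtain ⟨v, rfl, hv⟩ := (mem_body_iff ρ x).1 hx
    rw [liftV_encode]
    rcases (bodyL_vars ρ v).1 hv with rfl | ⟨p, hp, rfl⟩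
    · exact ⟨rfl, le_rfl⟩
    · exact ⟨rfl, hposs p hp⟩
  refine ⟨liftV (.leaf 0, 0) (newval g m), fun x hx => (agree x ((mem_frontier _ _).1 hx).1).1, ?_, ?_⟩
  · intro b hb
    obtain ⟨a, ha, rfl⟩ := List.mem_map.1 hb
    rw [mkAtom_map]
    simp only [liftV_encode]
    simp only [headL, List.mem_cons] at ha
    rcases ha with rfl | rfl | ha
    · refine ⟨?_, newval_rk g m _ huse, hmB⟩
      rw [newval_nm]; exact hreach
    · exact ⟨(Nat.le_succ m).trans hmB, hmB⟩
    · exact Mdl_rflat R s0 B g m hmB ρ.2 huse a ha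
  · intro z hz hzb
    refine ⟨m, ?_, fun x hx => ?_⟩
    · obtain ⟨v, rfl, hv⟩ := (mem_head_iff ρ z).1 hz
      rw [liftV_encode]
      rw [mem_body_iff] at hzb
      have hnb : ¬ (v = told ∨ ∃ p ∈ ρ.1.poss [], v = .inl p) :=
        fun h => hzb ⟨v, rfl, (bodyL_vars ρ v).2 h⟩
      rcases headL_vars ρ v hv with rfl | rfl | ⟨p, hp, rfl⟩ | ⟨q, rfl⟩
      · exact absurd (Or.inl rfl) hnb
      · rfl
      · exact absurd (Or.inr ⟨p, hR ρ hρ p hp, rfl⟩) hnb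
      · rfl
    · have := agree x ((mem_frontier _ _).1 hx).1
      rw [this.1]; exact this.2

/-! #### Non-termination -/

inductive Rep (I : Instance) : TermT → Tr → Prop
  | leaf {t i} : (⟨i, [t]⟩ : Atom TermT) ∈ I → Rep I t (.leaf i)
  | pair {t a b A B} : (⟨0, [t, a, b]⟩ : Atom TermT) ∈ I → Rep I a A → Rep I b B →
      Rep I t (.pair A B)

theorem match_terms (I : Instance) (l : LP) (θ : List Bool → Tr) (h : List Bool → TermT)
    (hh : ∀ p, Rep I (h p) (.pair (θ (false :: p)) (θ (true :: p))) →
      (⟨0, [h p, h (false :: p), h (true :: p)]⟩ : Atom TermT) ∈ I ∧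
      Rep I (h (false :: p)) (θ (false :: p)) ∧ Rep I (h (true :: p)) (θ (true :: p))) (k : Vr → TermT)
    (hk : ∀ p, k (.inl p) = h p) :
    ∀ p, l.Matches θ p → Rep I (h p) (θ p) →
      (∀ a ∈ l.flat p, (⟨a.1, a.2.map k⟩ : Atom TermT) ∈ I) ∧
      ∀ q ∈ l.poss p, Rep I (h q) (θ q) := by
  induction l with
  | any => intro p _ hr; simpa [LP.flat, LP.poss] using hr
  | leaf i =>
    intro p hm hr
    refine ⟨?_, by simpa [LP.poss] using hr⟩
    intro a ha
    simp only [LP.flat, List.mem_singleton] at ha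
    subst ha
    simp only [LP.Matches] at hm
    rw [hm] at hr
    cases hr with
    | leaf hr => simpa [hk] using hr
  | pair a b iha ihb =>
    rintro p ⟨m0, m1, m2⟩ hr
    have hr' := hr
    rw [m0] at hr'
    obtain ⟨x0, x1, x2⟩ := hh p hr'
    obtain ⟨a1, a2⟩ := iha _ m1 x1
    obtain ⟨b1, b2⟩ := ihb _ m2 x2
    constructor
    · intro y hy
      simp only [LP.flat, List.mem_cons, List.mem_append] at hy
      rcases hy with rfl | hy | hy
      · simpa [hk] using x0
      · exact a1 y hy
      · exact b1 y hy
    · intro q hq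
      simp only [LP.poss, List.mem_cons, List.mem_append] at hq
      rcases hq with rfl | hq | hq
      · exact hr
      · exact a2 q hq
      · exact b2 q hq

open Classical in
noncomputable def children (I : Instance) (t : TermT) (A B : Tr) : TermT × TermT :=
  if h : ∃ x : TermT × TermT, (⟨0, [t, x.1, x.2]⟩ : Atom TermT) ∈ I ∧
      Rep I x.1 A ∧ Rep I x.2 B then h.choose else (t, t)

theorem children_spec (I : Instance) (t : TermT) (A B : Tr) (hr : Rep I t (.pair A B)) :
    (⟨0, [t, (children I t A B).1, (children I t A B).2]⟩ : Atom TermT) ∈ I ∧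
      Rep I (children I t A B).1 A ∧ Rep I (children I t A B).2 B := by
  have h : ∃ x : TermT × TermT, (⟨0, [t, x.1, x.2]⟩ : Atom TermT) ∈ I ∧
      Rep I x.1 A ∧ Rep I x.2 B := by
    cases hr with
    | @pair _ a b _ _ h1 h2 h3 => exact ⟨(a, b), h1, h2, h3⟩
  unfold children
  rw [dif_pos h]
  exact h.choose_spec

noncomputable def walk (I : Instance) (θ : List Bool → Tr) (t : TermT) : List Bool → TermT
  | [] => t
  | false :: p => (children I (walk I θ t p) (θ (false :: p)) (θ (true :: p))).1
  | true :: p => (children I (walk I θ t p) (θ (false :: p)) (θ (true :: p))).2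

theorem Rep_rhs (I : Instance) (θ : List Bool → Tr) (k : Vr → TermT) (r : RP)
    (hf : ∀ a ∈ r.flat, (⟨a.1, a.2.map k⟩ : Atom TermT) ∈ I)
    (hu : ∀ p ∈ r.uses, Rep I (k (.inl p)) (θ p)) : Rep I (k r.nm) (r.eval θ) := by
  induction r with
  | pos p => exact hu p (by simp [RP.uses])
  | leaf i => exact Rep.leaf (hf _ (List.mem_singleton.2 rfl))
  | pair a b iha ihb =>
    exact Rep.pair (hf _ List.mem_cons_self)
      (iha (fun x hx => hf x (by simp [RP.flat, hx])) (fun p hp => hu p (by simp [RP.uses, hp])))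
      (ihb (fun x hx => hf x (by simp [RP.flat, hx])) (fun p hp => hu p (by simp [RP.uses, hp])))

theorem rflat_occ (r : RP) : ∀ p ∈ r.uses, r.nm = .inl p ∨ ∃ a ∈ r.flat, (.inl p : Vr) ∈ a.2 := by
  induction r with
  | pos q => intro p hp; left; simp only [RP.uses, List.mem_singleton] at hp; rw [hp]; rfl
  | leaf i => intro p hp; simp [RP.uses] at hp
  | pair a b iha ihb =>
    intro p hp
    right
    simp only [RP.uses, List.mem_append] at hp
    rcases hp with hp | hp
    · rcases iha p hp with h | ⟨x, hx, h⟩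
      · exact ⟨_, List.mem_cons_self, by simp [h]⟩
      · exact ⟨x, by simp [RP.flat, hx], h⟩
    · rcases ihb p hp with h | ⟨x, hx, h⟩
      · exact ⟨_, List.mem_cons_self, by simp [h]⟩
      · exact ⟨x, by simp [RP.flat, hx], h⟩

theorem step_chase (R : List Rule) (hR : ∀ ρ ∈ R, Rule.WF ρ) (D : Database) (s s' : Tr)
    (hs : Step R s s') (x t : TermT) (hx : (⟨0, [x, t]⟩ : Atom TermT) ∈ chase D (tgds R))
    (hr : Rep (chase D (tgds R)) x s) :
    ∃ x' t', (⟨0, [x', t']⟩ : Atom TermT) ∈ chase D (tgds R) ∧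
      Rep (chase D (tgds R)) x' s' ∧ t.depth < t'.depth := by
  obtain ⟨ρ, hρ, θ, rfl, hm, rfl⟩ := hs
  set I := chase D (tgds R) with hI
  set k : Vr → TermT := fun v => match v with
    | .inl p => walk I θ x p
    | .inr _ => t with hk
  obtain ⟨f1, f2⟩ := match_terms I ρ.1 θ (walk I θ x) (fun p hp => children_spec I _ _ _ hp) k
    (fun p => rfl) [] hm hr
  set h : ℕ → TermT := liftV t k with hh
  have hbody : ∀ b ∈ (mkTGD ρ).body, InChase D (tgds R) (b.map h) := by
    intro b hb
    obtain ⟨a, ha, rfl⟩ := List.mem_map.1 hb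
    have e : (mkAtom a).map h = ⟨a.1, a.2.map k⟩ := by
      simp only [Atom.map, mkAtom_map, hh, liftV_encode]; rfl
    rw [e]
    simp only [bodyL, List.mem_cons] at ha
    rcases ha with rfl | ha
    · exact hx
    · exact f1 a ha
  set μ : Vr → TermT := fun v => (mkTGD ρ).mu h (encode v) with hμ
  have hhead : ∀ a ∈ headL ρ, (⟨a.1, a.2.map μ⟩ : Atom TermT) ∈ I := by
    intro a ha
    have hσ : mkTGD ρ ∈ tgds R := ⟨ρ, hρ, rfl⟩
    have hres : (⟨a.1, a.2.map μ⟩ : Atom TermT) ∈ (mkTGD ρ).result h := by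
      refine ⟨mkAtom a, List.mem_map_of_mem ha, ?_⟩
      simp only [Atom.map, mkAtom_map]; rfl
    exact InChase.step hσ h hbody hres
  have hfr : ∀ v : Vr, (∃ a ∈ bodyL ρ, v ∈ a.2) → (∃ a ∈ headL ρ, v ∈ a.2) →
      encode v ∈ (mkTGD ρ).frontier := fun v h1 h2 =>
    (mem_frontier _ _).2 ⟨(mem_body_iff _ _).2 ⟨v, rfl, h1⟩, (mem_head_iff _ _).2 ⟨v, rfl, h2⟩⟩
  have htold : encode told ∈ (mkTGD ρ).frontier :=
    hfr told ((bodyL_vars _ _).2 (Or.inl rfl)) ⟨(1, [told, tnew]), by simp [headL], by simp⟩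
  have htnew : encode tnew ∉ (mkTGD ρ).frontier := by
    intro hc
    obtain ⟨v, e, hv⟩ := (mem_body_iff _ _).1 ((mem_frontier _ _).1 hc).1
    have := encode_injective e
    subst this
    rcases (bodyL_vars _ _).1 hv with h | ⟨p, _, h⟩ <;> simp at h
  have hpos : ∀ p ∈ ρ.2.uses, μ (.inl p) = walk I θ x p := by
    intro p hp
    have : encode (.inl p : Vr) ∈ (mkTGD ρ).frontier := by
      refine hfr _ ((bodyL_vars _ _).2 (Or.inr ⟨p, hR ρ hρ p hp, rfl⟩)) ?_
      rcases rflat_occ ρ.2 p hp with h | ⟨a, ha, h⟩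
      · exact ⟨_, List.mem_cons_self, by simp [h]⟩
      · exact ⟨a, by simp [headL, ha], h⟩
    simp only [hμ, TGD.mu, if_pos this, hh, liftV_encode, hk]
  refine ⟨μ ρ.2.nm, μ tnew, hhead _ List.mem_cons_self, ?_, ?_⟩
  · refine Rep_rhs I θ μ ρ.2 (fun a ha => hhead a (by simp [headL, ha])) ?_
    intro p hp
    rw [hpos p hp]
    exact f2 p (hR ρ hρ p hp)
  · have e : μ tnew = .null (mkTGD ρ) ((mkTGD ρ).restrict h) (encode tnew) := by
      simp only [hμ, TGD.mu, if_neg htnew]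
    rw [e, TermT.depth]
    have h1 : ((mkTGD ρ).restrict h (encode told)) = t := by
      simp only [TGD.restrict, if_pos htold, hh, liftV_encode, hk]
    have := Finset.le_sup (f := fun y => ((mkTGD ρ).restrict h y).depth) htold
    simp only [h1] at this
    omega

def secondDepth (a : Atom TermT) : ℕ :=
  match a.args with
  | [_, t] => t.depth
  | _ => 0

theorem diverges (R : List Rule) (hR : ∀ ρ ∈ R, Rule.WF ρ) (s0 : Tr) (P : Tr → Prop) (h0 : P s0)
    (hP : ∀ s, P s → ∃ s', Step R s s' ∧ P s') (D : Database) (x t : TermT)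
    (hx : (⟨0, [x, t]⟩ : Atom TermT) ∈ chase D (tgds R)) (hr : Rep (chase D (tgds R)) x s0) :
    ¬ (chase D (tgds R)).Finite := by
  intro hfin
  have key : ∀ n : ℕ, ∃ s x t, P s ∧ (⟨0, [x, t]⟩ : Atom TermT) ∈ chase D (tgds R) ∧
      Rep (chase D (tgds R)) x s ∧ n ≤ t.depth := by
    intro n
    induction n with
    | zero => exact ⟨s0, x, t, h0, hx, hr, Nat.zero_le _⟩
    | succ n ih =>
      obtain ⟨s, x, t, hs, hx, hr, hn⟩ := ih
      obtain ⟨s', hst, hs'⟩ := hP s hs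
      obtain ⟨x', t', h1, h2, h3⟩ := step_chase R hR D s s' hst x t hx hr
      exact ⟨s', x', t', hs', h1, h2, by omega⟩
  obtain ⟨N, hN⟩ := (hfin.image secondDepth).bddAbove
  obtain ⟨s, x, t, _, h1, _, h2⟩ := key (N + 1)
  have := hN ⟨_, h1, rfl⟩
  simp only [secondDepth] at this
  omega

end ChaseUndec

namespace ChaseUndec

set_option linter.unusedSimpArgs false

open Encodable Turing.ToPartrec

/-! ### A rewriting system evaluating `ToPartrec.Code` -/

def num : ℕ → Tr
  | 0 => .leaf 0
  | n + 1 => .pair (.leaf 0) (num n)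

def lst : List ℕ → Tr
  | [] => .leaf 0
  | a :: l => .pair (num a) (lst l)

def cod : Code → Tr
  | .zero' => .leaf 1
  | .succ => .leaf 2
  | .tail => .leaf 3
  | .cons f g => .pair (.leaf 4) (.pair (cod f) (cod g))
  | .comp f g => .pair (.leaf 5) (.pair (cod f) (cod g))
  | .case f g => .pair (.leaf 6) (.pair (cod f) (cod g))
  | .fix f => .pair (.leaf 7) (cod f)

def con : Cont → Tr
  | .halt => .leaf 8
  | .cons₁ f l k => .pair (.leaf 9) (.pair (cod f) (.pair (lst l) (con k)))
  | .cons₂ l k => .pair (.leaf 10) (.pair (lst l) (con k))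
  | .comp f k => .pair (.leaf 11) (.pair (cod f) (con k))
  | .fix f k => .pair (.leaf 12) (.pair (cod f) (con k))

abbrev stE (f k v : Tr) : Tr := .pair (.leaf 1) (.pair f (.pair k v))
abbrev stR (k v : Tr) : Tr := .pair (.leaf 2) (.pair k v)

def Tr.toRP : Tr → RP
  | .leaf i => .leaf i
  | .pair a b => .pair a.toRP b.toRP

@[simp] theorem toRP_eval (θ : List Bool → Tr) (t : Tr) : t.toRP.eval θ = t := by
  induction t with
  | leaf i => rfl
  | pair a b iha ihb => simp [Tr.toRP, RP.eval, iha, ihb]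

@[simp] theorem toRP_uses (t : Tr) : t.toRP.uses = [] := by
  induction t with
  | leaf i => rfl
  | pair a b iha ihb => simp [Tr.toRP, RP.uses, iha, ihb]

abbrev lE (f k v : LP) : LP := .pair (.leaf 1) (.pair f (.pair k v))
abbrev lR (k v : LP) : LP := .pair (.leaf 2) (.pair k v)
abbrev rE (f k v : RP) : RP := .pair (.leaf 1) (.pair f (.pair k v))
abbrev rR (k v : RP) : RP := .pair (.leaf 2) (.pair k v)

/-- Position given by the path from the root. -/
abbrev atp (p : List Bool) : RP := .pos p.reverse

abbrev bo : Bool := false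
abbrev bi : Bool := true

abbrev pF : RP := atp [bi, bo]
abbrev pK : RP := atp [bi, bi, bo]
abbrev pV : RP := atp [bi, bi, bi]
abbrev qK : RP := atp [bi, bo]
abbrev qV : RP := atp [bi, bi]

def rules (c : Code) : List Rule :=
  [ (.pair (.leaf 0) .any, rE (cod c).toRP (.leaf 8) (.pair (atp [bi]) (.leaf 0))),
    (lE (.leaf 1) .any .any, rR pK (.pair (.leaf 0) pV)),
    (lE (.leaf 2) .any (.leaf 0), rR pK (.pair (.pair (.leaf 0) (.leaf 0)) (.leaf 0))),
    (lE (.leaf 2) .any (.pair .any .any),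
      rR pK (.pair (.pair (.leaf 0) (atp [bi, bi, bi, bo])) (.leaf 0))),
    (lE (.leaf 3) .any (.leaf 0), rR pK (.leaf 0)),
    (lE (.leaf 3) .any (.pair .any .any), rR pK (atp [bi, bi, bi, bi])),
    (lE (.pair (.leaf 4) (.pair .any .any)) .any .any,
      rE (atp [bi, bo, bi, bo]) (.pair (.leaf 9) (.pair (atp [bi, bo, bi, bi]) (.pair pV pK))) pV),
    (lE (.pair (.leaf 5) (.pair .any .any)) .any .any,
      rE (atp [bi, bo, bi, bi]) (.pair (.leaf 11) (.pair (atp [bi, bo, bi, bo]) pK)) pV),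
    (lE (.pair (.leaf 6) (.pair .any .any)) .any (.leaf 0), rE (atp [bi, bo, bi, bo]) pK (.leaf 0)),
    (lE (.pair (.leaf 6) (.pair .any .any)) .any (.pair (.leaf 0) .any),
      rE (atp [bi, bo, bi, bo]) pK (atp [bi, bi, bi, bi])),
    (lE (.pair (.leaf 6) (.pair .any .any)) .any (.pair (.pair (.leaf 0) .any) .any),
      rE (atp [bi, bo, bi, bi]) pK (.pair (atp [bi, bi, bi, bo, bi]) (atp [bi, bi, bi, bi]))),
    (lE (.pair (.leaf 7) .any) .any .any,
      rE (atp [bi, bo, bi]) (.pair (.leaf 12) (.pair (atp [bi, bo, bi]) pK)) pV),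
    (lR (.pair (.leaf 9) (.pair .any (.pair .any .any))) .any,
      rE (atp [bi, bo, bi, bo]) (.pair (.leaf 10) (.pair qV (atp [bi, bo, bi, bi, bi]))) (atp [bi, bo, bi, bi, bo])),
    (lR (.pair (.leaf 10) (.pair (.leaf 0) .any)) .any,
      rR (atp [bi, bo, bi, bi]) (.pair (.leaf 0) qV)),
    (lR (.pair (.leaf 10) (.pair (.pair .any .any) .any)) .any,
      rR (atp [bi, bo, bi, bi]) (.pair (atp [bi, bo, bi, bo, bo]) qV)),
    (lR (.pair (.leaf 11) (.pair .any .any)) .any,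
      rE (atp [bi, bo, bi, bo]) (atp [bi, bo, bi, bi]) qV),
    (lR (.pair (.leaf 12) (.pair .any .any)) (.leaf 0), rR (atp [bi, bo, bi, bi]) (.leaf 0)),
    (lR (.pair (.leaf 12) (.pair .any .any)) (.pair (.leaf 0) .any),
      rR (atp [bi, bo, bi, bi]) (atp [bi, bi, bi])),
    (lR (.pair (.leaf 12) (.pair .any .any)) (.pair (.pair (.leaf 0) .any) .any),
      rE (atp [bi, bo, bi, bo]) qK (atp [bi, bi, bi])) ]

theorem rules_wf (c : Code) : ∀ ρ ∈ rules c, Rule.WF ρ := by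
  simp [rules, Rule.WF, RP.uses, LP.poss]

def follow (s : Tr) : List Bool → Tr
  | [] => s
  | false :: p => match follow s p with
    | .pair a _ => a
    | t => t
  | true :: p => match follow s p with
    | .pair _ b => b
    | t => t

/-- The intended transition function. -/
inductive Det (c : Code) : Tr → Tr → Prop
  | init {n} : Det c (num (n + 1)) (stE (cod c) (con .halt) (lst [n]))
  | zero {k v} : Det c (stE (cod .zero') (con k) (lst v)) (stR (con k) (lst (0 :: v)))
  | succ {k v} : Det c (stE (cod .succ) (con k) (lst v)) (stR (con k) (lst [v.headI.succ]))
  | tail {k v} : Det c (stE (cod .tail) (con k) (lst v)) (stR (con k) (lst v.tail))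
  | cons {f g k v} : Det c (stE (cod (.cons f g)) (con k) (lst v))
      (stE (cod f) (con (.cons₁ g v k)) (lst v))
  | comp {f g k v} : Det c (stE (cod (.comp f g)) (con k) (lst v))
      (stE (cod g) (con (.comp f k)) (lst v))
  | case {f g k v} : Det c (stE (cod (.case f g)) (con k) (lst v))
      (v.headI.rec (stE (cod f) (con k) (lst v.tail))
        fun y _ => stE (cod g) (con k) (lst (y :: v.tail)))
  | fix {f k v} : Det c (stE (cod (.fix f)) (con k) (lst v))
      (stE (cod f) (con (.fix f k)) (lst v))
  | rcons₁ {f l k v} : Det c (stR (con (.cons₁ f l k)) (lst v))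
      (stE (cod f) (con (.cons₂ v k)) (lst l))
  | rcons₂ {l k v} : Det c (stR (con (.cons₂ l k)) (lst v))
      (stR (con k) (lst (l.headI :: v)))
  | rcomp {f k v} : Det c (stR (con (.comp f k)) (lst v))
      (stE (cod f) (con k) (lst v))
  | rfix {f k v} : Det c (stR (con (.fix f k)) (lst v))
      (if v.headI = 0 then stR (con k) (lst v.tail)
        else stE (cod f) (con (.fix f k)) (lst v.tail))

theorem matches_follow (s : Tr) (θ : List Bool → Tr) (l : LP) : ∀ p, l.Matches θ p →
    follow s p = θ p → l.Matches (follow s) p ∧ ∀ q ∈ l.poss p, follow s q = θ q := by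
  induction l with
  | any => intro p h e; simp [LP.Matches, LP.poss, e]
  | leaf j => intro p h e; simp only [LP.Matches] at h; simp [LP.Matches, LP.poss, e, h]
  | pair a b iha ihb =>
    intro p h e
    simp only [LP.Matches] at h
    obtain ⟨h1, h2, h3⟩ := h
    have e1 : follow s (false :: p) = θ (false :: p) := by simp [follow, e, h1]
    have e2 : follow s (true :: p) = θ (true :: p) := by simp [follow, e, h1]
    obtain ⟨a1, a2⟩ := iha _ h2 e1
    obtain ⟨b1, b2⟩ := ihb _ h3 e2
    refine ⟨⟨by rw [e, h1, e1, e2], a1, b1⟩, ?_⟩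
    intro q hq
    simp only [LP.poss, List.mem_cons, List.mem_append] at hq
    rcases hq with rfl | hq | hq
    · exact e
    · exact a2 q hq
    · exact b2 q hq

theorem eval_congr (θ θ' : List Bool → Tr) (r : RP) (h : ∀ p ∈ r.uses, θ p = θ' p) :
    r.eval θ = r.eval θ' := by
  induction r with
  | pos p => exact h p (by simp [RP.uses])
  | leaf j => rfl
  | pair a b iha ihb =>
    simp only [RP.eval]
    rw [iha (fun p hp => h p (by simp [RP.uses, hp])), ihb (fun p hp => h p (by simp [RP.uses, hp]))]

theorem Step_iff (c : Code) (s s' : Tr) : Step (rules c) s s' ↔ ∃ ρ ∈ rules c,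
    ρ.1.Matches (follow s) [] ∧ s' = ρ.2.eval (follow s) := by
  constructor
  · rintro ⟨ρ, hρ, θ, rfl, hm, rfl⟩
    obtain ⟨h1, h2⟩ := matches_follow (θ []) θ ρ.1 [] hm rfl
    exact ⟨ρ, hρ, h1, eval_congr _ _ _ fun p hp => (h2 p (rules_wf c ρ hρ p hp)).symm⟩
  · rintro ⟨ρ, hρ, hm, rfl⟩
    exact ⟨ρ, hρ, follow s, rfl, hm, rfl⟩

theorem det_step {c : Code} {s s' : Tr} (h : Det c s s') : Step (rules c) s s' := by
  refine (Step_iff _ _ _).2 ?_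
  cases h with
  | @succ k v =>
    rcases v with _ | ⟨_ | a, v⟩ <;> simp [rules, LP.Matches, RP.eval, follow, cod, con, lst, num]
  | @tail k v =>
    rcases v with _ | ⟨_ | a, v⟩ <;> simp [rules, LP.Matches, RP.eval, follow, cod, con, lst, num]
  | @case f g k v =>
    rcases v with _ | ⟨_ | a, v⟩ <;> simp [rules, LP.Matches, RP.eval, follow, cod, con, lst, num]
  | @rcons₂ l k v =>
    rcases l with _ | ⟨_ | a, v⟩ <;> simp [rules, LP.Matches, RP.eval, follow, cod, con, lst, num]
  | @rfix f k v =>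
    rcases v with _ | ⟨_ | a, v⟩ <;> simp [rules, LP.Matches, RP.eval, follow, cod, con, lst, num]
  | _ => simp [rules, LP.Matches, RP.eval, follow, cod, con, lst, num]

theorem det_unique {c : Code} {s s' : Tr} (h : Det c s s') (x : Tr) (hx : Step (rules c) s x) :
    x = s' := by
  rw [Step_iff] at hx
  cases h with
  | @succ k v =>
    rcases v with _ | ⟨_ | a, v⟩ <;> simpa [rules, LP.Matches, RP.eval, follow, cod, con, lst, num] using hx
  | @tail k v =>
    rcases v with _ | ⟨_ | a, v⟩ <;> simpa [rules, LP.Matches, RP.eval, follow, cod, con, lst, num] using hx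
  | @case f g k v =>
    rcases v with _ | ⟨_ | a, v⟩ <;> simpa [rules, LP.Matches, RP.eval, follow, cod, con, lst, num] using hx
  | @rcons₂ l k v =>
    rcases l with _ | ⟨_ | a, v⟩ <;> simpa [rules, LP.Matches, RP.eval, follow, cod, con, lst, num] using hx
  | @rfix f k v =>
    rcases v with _ | ⟨_ | a, v⟩ <;> simpa [rules, LP.Matches, RP.eval, follow, cod, con, lst, num] using hx
  | _ => simpa [rules, LP.Matches, RP.eval, follow, cod, con, lst, num] using hx

theorem halt_nostep {c : Code} {v : List ℕ} (x : Tr) : ¬ Step (rules c) (stR (con .halt) (lst v)) x := by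
  rw [Step_iff]
  simp [rules, LP.Matches, RP.eval, follow, cod, con, lst, num]

def Term (c : Code) (s : Tr) : Prop := ∃ B, ∀ n s', Reach (rules c) s n s' → n ≤ B

theorem reach_head {R : List Rule} {s : Tr} {n : ℕ} {s' : Tr} (h : Reach R s n s') :
    n = 0 ∨ ∃ x m, Step R s x ∧ n = m + 1 ∧ Reach R x m s' := by
  induction h with
  | zero => left; rfl
  | @succ n a b h1 h2 ih =>
    right
    rcases ih with rfl | ⟨x, m, hx, rfl, hr⟩
    · cases h1
      exact ⟨b, 0, h2, rfl, Reach.zero⟩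
    · exact ⟨x, m + 1, hx, rfl, Reach.succ hr h2⟩

theorem term_of_det {c : Code} {s s' : Tr} (h : Det c s s') (ht : Term c s') : Term c s := by
  obtain ⟨B, hB⟩ := ht
  refine ⟨B + 1, fun n x hn => ?_⟩
  rcases reach_head hn with rfl | ⟨y, m, hy, rfl, hr⟩
  · omega
  · rw [det_unique h y hy] at hr
    have := hB _ _ hr
    omega

theorem term_halt {c : Code} {v : List ℕ} : Term c (stR (con .halt) (lst v)) := by
  refine ⟨0, fun n x hn => ?_⟩
  rcases reach_head hn with rfl | ⟨y, m, hy, rfl, hr⟩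
  · omega
  · exact (halt_nostep y hy).elim

theorem term_eval (c : Code) (f : Code) : ∀ (v w : List ℕ) (k : Cont), w ∈ f.eval v →
    Term c (stR (con k) (lst w)) → Term c (stE (cod f) (con k) (lst v)) := by
  induction f with
  | zero' =>
    intro v w k hw ht
    simp at hw; subst hw
    exact term_of_det .zero ht
  | succ =>
    intro v w k hw ht
    simp at hw; subst hw
    exact term_of_det .succ ht
  | tail =>
    intro v w k hw ht
    simp at hw; subst hw
    exact term_of_det .tail ht
  | cons f g ihf ihg =>
    intro v w k hw ht
    simp at hw
    obtain ⟨w1, h1, w2, h2, rfl⟩ := hw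
    exact term_of_det .cons (ihf v w1 _ h1 (term_of_det .rcons₁
      (ihg v w2 _ h2 (term_of_det .rcons₂ ht))))
  | comp f g ihf ihg =>
    intro v w k hw ht
    rw [Code.comp_eval] at hw
    obtain ⟨w1, h1, h2⟩ := Part.mem_bind_iff.1 hw
    exact term_of_det .comp (ihg v w1 _ h1 (term_of_det .rcomp (ihf w1 w _ h2 ht)))
  | case f g ihf ihg =>
    intro v w k hw ht
    refine term_of_det .case ?_
    simp only [Code.case_eval] at hw
    cases h : v.headI with
    | zero => rw [h] at hw; exact ihf _ _ _ hw ht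
    | succ y => rw [h] at hw; exact ihg _ _ _ hw ht
  | fix f ih =>
    intro v w k hw ht
    rw [Code.fix_eval] at hw
    refine term_of_det .fix ?_
    refine PFun.fixInduction' (C := fun v => Term c (stE (cod f) (con (.fix f k)) (lst v))) hw ?_ ?_
    · intro a ha
      obtain ⟨u, hu, e⟩ := (Part.mem_map_iff _).1 ha
      refine ih a u _ hu (term_of_det .rfix ?_)
      split_ifs at e ⊢ with h0
      · simp at e; rw [e]; exact ht
    · intro a a' ha' hr IH
      obtain ⟨u, hu, e⟩ := (Part.mem_map_iff _).1 hr
      refine ih a u _ hu (term_of_det .rfix ?_)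
      split_ifs at e ⊢ with h0
      · simp at e; rw [e]; exact IH

theorem fix_dom (f : Code) (k : Cont) (v : List ℕ)
    (h : (f.eval v >>= Cont.eval (Cont.fix f k)).Dom) : (f.fix.eval v >>= k.eval).Dom := by
  obtain ⟨x, hx⟩ := Part.dom_iff_mem.1 h
  obtain ⟨u, hu, hx⟩ := Part.mem_bind_iff.1 hx
  refine Part.dom_iff_mem.2 ⟨x, ?_⟩
  simp only [Cont.eval] at hx
  split_ifs at hx with h0
  · refine Part.mem_bind_iff.2 ⟨u.tail, ?_, hx⟩
    rw [Code.fix_eval]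
    exact PFun.fix_stop ((Part.mem_map_iff _).2 ⟨u, hu, by simp [h0]⟩)
  · obtain ⟨w, hw, hx⟩ := Part.mem_bind_iff.1 hx
    refine Part.mem_bind_iff.2 ⟨w, ?_, hx⟩
    rw [Code.fix_eval] at hw ⊢
    exact (PFun.mem_fix_iff).2 (Or.inr ⟨u.tail, (Part.mem_map_iff _).2 ⟨u, hu, by simp [h0]⟩, hw⟩)

/-- Diverging states. -/
inductive Div (c : Code) : Tr → Prop
  | init {n} : ¬ (c.eval [n]).Dom → Div c (num (n + 1))
  | ev {f k v} : ¬ (f.eval v >>= Cont.eval k).Dom → Div c (stE (cod f) (con k) (lst v))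
  | ret {k v} : ¬ (Cont.eval k v).Dom → Div c (stR (con k) (lst v))

theorem bd1 (a : List ℕ) (k : List ℕ → Part (List ℕ)) (h : (k a).Dom) : (Part.some a >>= k).Dom := by
  rw [Part.bind_eq_bind, Part.bind_some]; exact h

theorem bd2 (a : Part (List ℕ)) (f k : List ℕ → Part (List ℕ)) (h : (a >>= fun x => f x >>= k).Dom) :
    ((a >>= f) >>= k).Dom := by
  rw [bind_assoc]; exact h

theorem bd3 (a b : Part (List ℕ)) (k : List ℕ → Part (List ℕ))
    (h : (a >>= fun x => b >>= fun y => k (x.headI :: y)).Dom) :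
    ((a >>= fun x => b >>= fun y => pure (x.headI :: y)) >>= k).Dom := by
  simp only [bind_assoc, pure_bind]; exact h

theorem fix_nd (c f : Code) (k : Cont) (v : List ℕ) (h : ¬ (f.fix.eval v >>= k.eval).Dom) :
    Div c (stE (cod f) (con (.fix f k)) (lst v)) := .ev fun h' => h (fix_dom f k v h')

theorem div_step (c : Code) (s : Tr) (h : Div c s) : ∃ s', Step (rules c) s s' ∧ Div c s' := by
  suffices ∃ s', Det c s s' ∧ Div c s' by
    obtain ⟨s', h1, h2⟩ := this
    exact ⟨s', det_step h1, h2⟩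
  cases h with
  | @init n h =>
    refine ⟨_, .init, .ev ?_⟩
    intro h'
    exact h (Part.Dom.of_bind h')
  | @ev f k v h =>
    cases f with
    | zero' => exact ⟨_, .zero, .ret fun h' => h (by rw [Code.zero'_eval]; exact bd1 _ _ h')⟩
    | succ => exact ⟨_, .succ, .ret fun h' => h (by rw [Code.succ_eval]; exact bd1 _ _ h')⟩
    | tail => exact ⟨_, .tail, .ret fun h' => h (by rw [Code.tail_eval]; exact bd1 _ _ h')⟩
    | cons f g => exact ⟨_, .cons, .ev fun h' => h (by rw [Code.cons_eval]; exact bd3 _ _ _ h')⟩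
    | comp f g => exact ⟨_, .comp, .ev fun h' => h (by rw [Code.comp_eval]; exact bd2 _ _ _ h')⟩
    | case f g =>
      refine ⟨_, .case, ?_⟩
      simp only [Code.case_eval] at h
      cases h0 : v.headI with
      | zero => rw [h0] at h; exact .ev h
      | succ y => rw [h0] at h; exact .ev h
    | fix f => 
      exact ⟨_, .fix, fix_nd c f k v h⟩
  | @ret k v h =>
    cases k with
    | halt => simp [Cont.eval, pure, PFun.pure] at h
    | cons₁ f l k => exact ⟨_, .rcons₁, .ev (by simpa [Cont.eval] using h)⟩
    | cons₂ l k => exact ⟨_, .rcons₂, .ret (by simpa [Cont.eval] using h)⟩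
    | comp f k => exact ⟨_, .rcomp, .ev (by simpa [Cont.eval] using h)⟩
    | fix f k =>
      refine ⟨_, .rfix, ?_⟩
      simp only [Cont.eval] at h
      split_ifs at h ⊢ with h0
      · exact .ret h
      · exact fix_nd c f k _ h

end ChaseUndec

namespace ChaseUndec

open Encodable Turing.ToPartrec

/-! ### The input databases -/

def dbList (n : ℕ) : List (List ℕ) :=
  [0] :: (((List.range (n + 1)).map fun j => [j + 1, 0, j]) ++ [[n + 1, encode [0, n]]])

def db (n : ℕ) : Database := ((dbList n).map (fun l => (⟨0, l⟩ : Atom ℕ))).toFinset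

theorem mem_db (n : ℕ) (a : Atom ℕ) : a ∈ db n ↔ a = ⟨0, [0]⟩ ∨
    (∃ j, j < n + 1 ∧ a = ⟨0, [j + 1, 0, j]⟩) ∨ a = ⟨0, [n + 1, encode [0, n]]⟩ := by
  simp only [db, dbList, List.mem_toFinset, List.map_cons, List.map_append, List.map_map,
    List.mem_cons, List.mem_append, List.mem_map, List.mem_range, Function.comp]
  constructor
  · rintro (h | ⟨j, hj, rfl⟩ | h)
    · exact Or.inl h
    · exact Or.inr (Or.inl ⟨j, hj, rfl⟩)
    · simp at h; exact Or.inr (Or.inr (by simp [h]))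
  · rintro (h | ⟨j, hj, rfl⟩ | h)
    · exact Or.inl h
    · exact Or.inr (Or.inl ⟨j, hj, rfl⟩)
    · exact Or.inr (Or.inr (by simp [h]))

theorem db_term (c : Code) (n : ℕ) (h : (c.eval [n]).Dom) :
    (chase (db n) (tgds (rules c))).Finite := by
  have ht : Term c (num (n + 1)) :=
    term_of_det .init (term_eval c c [n] _ .halt (Part.get_mem h) term_halt)
  obtain ⟨B, hB⟩ := ht
  refine terminates (rules c) (rules_wf c) (num (n + 1)) B hB (db n) (fun j => (num j, 0)) ?_
  intro a ha
  rcases (mem_db n a).1 ha with rfl | ⟨j, hj, rfl⟩ | rfl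
  · simp [Mdl, num]
  · simp [Mdl, num]
  · simp only [List.map, Mdl]
    exact ⟨Reach.zero, le_rfl, Nat.zero_le _⟩

theorem db_div (c : Code) (n : ℕ) (h : ¬ (c.eval [n]).Dom) :
    ¬ (chase (db n) (tgds (rules c))).Finite := by
  refine diverges (rules c) (rules_wf c) (num (n + 1)) (Div c) (.init h) (div_step c) (db n)
    (.const (n + 1)) (.const (encode [0, n])) ?_ ?_
  · exact InChase.db ((mem_db n _).2 (Or.inr (Or.inr rfl)))
  · have h0 : Rep (chase (db n) (tgds (rules c))) (.const 0) (num 0) :=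
      Rep.leaf (InChase.db ((mem_db n _).2 (Or.inl rfl)))
    have key : ∀ j, j ≤ n + 1 → Rep (chase (db n) (tgds (rules c))) (.const j) (num j) := by
      intro j
      induction j with
      | zero => intro _; exact h0
      | succ j ih =>
        intro hj
        exact Rep.pair (InChase.db ((mem_db n _).2 (Or.inr (Or.inl ⟨j, by omega, rfl⟩)))) h0
          (ih (by omega))
    exact key _ le_rfl

theorem encode_sorted {α : Type} [Encodable α] [DecidableEq α] (l : List α)
    (h : l.Pairwise fun a b => encode a < encode b) : encode l.toFinset = encode l := by
  have hn : l.Nodup := h.imp fun {a b} hab e => by subst e; exact lt_irrefl _ hab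
  have e1 : l.toFinset.val = (l : Multiset α) := by
    rw [List.toFinset_val, List.dedup_eq_self.2 hn]
  have e2 : encode l.toFinset = encode l.toFinset.val := rfl
  rw [e2, e1]
  have : IsLinearOrder α (encode ⁻¹'o (· ≤ ·)) :=
    (RelEmbedding.preimage ⟨encode, encode_injective⟩ (· ≤ ·)).isLinearOrder
  have e3 : encode (l : Multiset α) = encode (Multiset.sort (l : Multiset α) (encode ⁻¹'o (· ≤ ·))) := rfl
  rw [e3, Multiset.coe_sort, List.mergeSort_of_pairwise]
  exact h.imp fun {a b} hab => decide_eq_true (show encode a ≤ encode b from hab.le)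

theorem db_encode (n : ℕ) : encode (db n) = encode ((dbList n).map fun l => ((0 : ℕ), l)) := by
  have mono : ∀ a b : List ℕ, encode a < encode b →
      encode (⟨0, a⟩ : Atom ℕ) < encode (⟨0, b⟩ : Atom ℕ) := by
    intro a b h
    exact Nat.pair_lt_pair_right 0 h
  have hc : ∀ (a : ℕ) (l : List ℕ), encode (a :: l) = (Nat.pair a (encode l)).succ := fun a l => rfl
  have hs : (dbList n).Pairwise fun a b => encode a < encode b := by
    have hp : ∀ j x, encode ([j + 1, x] : List ℕ) > 1 := by
      intro j x
      rw [hc]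
      have := Nat.left_le_pair (j + 1) (encode [x])
      omega
    have hq : ∀ j x y, encode ([j + 1, x, y] : List ℕ) > 1 := by
      intro j x y
      rw [hc]
      have := Nat.left_le_pair (j + 1) (encode [x, y])
      omega
    have h01 : encode ([0] : List ℕ) = 1 := by decide
    have hT : ∀ T, T < encode ([T] : List ℕ) := by
      intro T
      rw [hc]
      have := Nat.left_le_pair T (encode ([] : List ℕ))
      omega
    have lt2 : ∀ {a b c d : ℕ}, a ≤ b → c < d → Nat.pair a c < Nat.pair b d := by
      intro a b c d h1 h2
      rcases h1.lt_or_eq with h1 | rfl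
      · exact (Nat.pair_lt_pair_left _ h1).trans (Nat.pair_lt_pair_right _ h2)
      · exact Nat.pair_lt_pair_right _ h2
    have lt3 : ∀ {a b : ℕ}, a < b → encode ([0, a] : List ℕ) < encode ([0, b] : List ℕ) := by
      intro a b h
      simp only [hc]
      exact Nat.succ_lt_succ (Nat.pair_lt_pair_right _ (Nat.succ_lt_succ (Nat.pair_lt_pair_left _ h)))
    refine List.pairwise_cons.2 ⟨?_, List.pairwise_append.2 ⟨?_, List.pairwise_singleton _ _, ?_⟩⟩
    · intro l hl
      rw [h01]
      simp only [List.mem_append, List.mem_map, List.mem_singleton] at hl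
      rcases hl with ⟨j, _, rfl⟩ | rfl
      · exact hq _ _ _
      · exact hp _ _
    · rw [List.pairwise_map]
      refine List.pairwise_lt_range.imp ?_
      intro a b h
      rw [hc, hc (b + 1)]
      exact Nat.succ_lt_succ (lt2 (by omega) (lt3 h))
    · intro l hl l' hl'
      simp only [List.mem_map, List.mem_range, List.mem_singleton] at hl hl'
      obtain ⟨j, hj, rfl⟩ := hl
      subst hl'
      rw [hc, hc (n + 1)]
      refine Nat.succ_lt_succ (lt2 (by omega) (lt_of_le_of_lt ?_ (hT _)))
      rcases (Nat.lt_succ_iff.1 hj).lt_or_eq with h | rfl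
      · exact (lt3 h).le
      · exact le_rfl
  rw [db, encode_sorted]
  · generalize dbList n = L
    induction L with
    | nil => rfl
    | cons a L ih =>
      rw [List.map_cons, List.map_cons, encode_list_cons, encode_list_cons, ih]
      rfl
  · rw [List.pairwise_map]
    exact hs.imp fun {a b} h => mono a b h

theorem db_primrec : Computable fun n => encode (db n) := by
  have h : Primrec fun n => (dbList n).map fun l => ((0 : ℕ), l) := by
    refine Primrec.list_map ?_ ((Primrec.const 0).pair Primrec.snd)
    refine Primrec.list_cons.comp (Primrec.const _) (Primrec.list_append.comp ?_ ?_)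
    · refine Primrec.list_map (Primrec.list_range.comp Primrec.succ) ?_
      exact Primrec.list_cons.comp (Primrec.succ.comp Primrec.snd)
        (Primrec.list_cons.comp (Primrec.const 0)
          (Primrec.list_cons.comp Primrec.snd (Primrec.const [])))
    · refine Primrec.list_cons.comp (Primrec.list_cons.comp Primrec.succ
        (Primrec.list_cons.comp ?_ (Primrec.const []))) (Primrec.const [])
      exact Primrec.encode.comp (Primrec.list_cons.comp (Primrec.const 0)
          (Primrec.list_cons.comp Primrec.id (Primrec.const [])))
  exact ((Primrec.encode.comp h).of_eq fun n => (db_encode n).symm).to_comp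

theorem exists_universal : ∃ c : Code, ∀ p : Nat.Partrec.Code,
    (c.eval [encode p]).Dom ↔ (p.eval 0).Dom := by
  let F : List.Vector ℕ 1 →. ℕ := fun v =>
    (Part.ofOption (decode (α := Nat.Partrec.Code) v.head)).bind fun p => p.eval 0
  have hF : Partrec F := by
    refine Partrec.bind (Computable.ofOption (Computable.decode.comp Primrec.vector_head.to_comp)) ?_
    exact Nat.Partrec.Code.eval_part.comp Computable.snd (Computable.const 0)
  obtain ⟨c, hc⟩ := Code.exists_code (Nat.Partrec'.of_part hF)
  refine ⟨c, fun p => ?_⟩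
  have := hc ⟨[encode p], rfl⟩
  have e : F ⟨[encode p], rfl⟩ = p.eval 0 := by
    show (Part.ofOption (decode (α := Nat.Partrec.Code) (encode p))).bind _ = _
    rw [encodek]; exact Part.bind_some _ _
  rw [e] at this
  show (c.eval (⟨[encode p], rfl⟩ : List.Vector ℕ 1).1).Dom ↔ _
  rw [this]
  rfl

end ChaseUndec

/-- There exists a finite set `Σ*` of TGDs such that no computable
function (on encodings of databases) decides, for every database `D`, whether
`chase(D,Σ*)` is finite. -/
theorem chase_termination_undecidable :
    ∃ S : Set TGD, S.Finite ∧
      ¬ ∃ f : ℕ → Bool, Computable f ∧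
        ∀ D : Database, (f (Encodable.encode D) = true ↔ InCT D S) := by
  obtain ⟨c, hc⟩ := ChaseUndec.exists_universal
  refine ⟨ChaseUndec.tgds (ChaseUndec.rules c), ChaseUndec.tgds_finite _, ?_⟩
  rintro ⟨f, hf, h⟩
  refine ComputablePred.halting_problem 0 ?_
  refine ComputablePred.computable_iff.2 ⟨fun p => f (Encodable.encode (ChaseUndec.db (Encodable.encode p))),
    hf.comp (ChaseUndec.db_primrec.comp Computable.encode), ?_⟩
  funext p
  refine propext ?_
  rw [h, ← hc p]
  constructor
  · exact ChaseUndec.db_term c _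
  · intro hfin
    by_contra hn
    exact ChaseUndec.db_div c _ hn hfin
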